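/- For all real parameters c₁, c₂, c₃, the second moment of the Bell-diagonal matrix ρ_BD(c₁,c₂,c₃) satisfies R^(2) = (c₁² + c₂² + c₃²)/9. -/

import Mathlib

open MeasureTheory Matrix Kronecker

noncomputable section

abbrev E3 : Type := EuclideanSpace ℝ (Fin 3)

/-- The unit sphere `S²` in `ℝ³`. -/
abbrev S2 : Type := Metric.sphere (0 : E3) 1

/-- The action of a linear isometry (rotation) of `ℝ³` on the unit sphere. -/
def sphereMap (f : E3 ≃ₗᵢ[ℝ] E3) (x : S2) : S2 :=
  ⟨f x, by
    have h : ‖(x : E3)‖ = 1 := by simpa using mem_sphere_zero_iff_norm.mp x.2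
    simp [mem_sphere_zero_iff_norm, h]⟩

/-- The three Pauli matrices `σ_x, σ_y, σ_z`. -/
def pauli : Fin 3 → Matrix (Fin 2) (Fin 2) ℂ
  | 0 => !![0, 1; 1, 0]
  | 1 => !![0, -Complex.I; Complex.I, 0]
  | 2 => !![1, 0; 0, -1]

/-- For a direction `u ∈ ℝ³`, the operator `σ_u = u₁σ₁ + u₂σ₂ + u₃σ₃`. -/
def pauliVec (u : Fin 3 → ℝ) : Matrix (Fin 2) (Fin 2) ℂ :=
  ∑ j, (u j : ℂ) • pauli j

/-- The coordinates of a point of the unit sphere `S²`. -/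
def coords (x : S2) : Fin 3 → ℝ := fun j => (x : E3) j

/-- The Bell-diagonal matrix `ρ_BD = (1/4)(I₄ + Σ_j c_j σ_j ⊗ σ_j)`. -/
def rhoBD (c₁ c₂ c₃ : ℝ) : Matrix (Fin 2 × Fin 2) (Fin 2 × Fin 2) ℂ :=
  (1 / 4 : ℂ) • (1 + (c₁ : ℂ) • (pauli 0 ⊗ₖ pauli 0) + (c₂ : ℂ) • (pauli 1 ⊗ₖ pauli 1)
    + (c₃ : ℂ) • (pauli 2 ⊗ₖ pauli 2))

/-- The `t`-th moment `R^(t) = ∬_{S²×S²} (Tr[ρ (σ_u ⊗ σ_w)])^t dμ(u) dμ(w)` of a two-qubit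
matrix `ρ` with respect to a measure `μ` on the sphere. -/
def twoQubitMoment (μ : Measure S2) (ρ : Matrix (Fin 2 × Fin 2) (Fin 2 × Fin 2) ℂ)
    (t : ℕ) : ℝ :=
  ∫ p : S2 × S2,
    ((ρ * (pauliVec (coords p.1) ⊗ₖ pauliVec (coords p.2))).trace).re ^ t ∂(μ.prod μ)

lemma continuous_coords (i : Fin 3) : Continuous fun x : S2 => coords x i := by
  unfold coords
  fun_prop

lemma continuous_sphereMap (f : E3 ≃ₗᵢ[ℝ] E3) : Continuous (sphereMap f) :=
  (f.continuous.comp continuous_subtype_val).subtype_mk _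

/-- The coordinate description of the expectation of `σ_u ⊗ σ_w` in a Bell-diagonal matrix. -/
lemma trace_rhoBD_mul_pauliVec (c₁ c₂ c₃ : ℝ) (u w : Fin 3 → ℝ) :
    ((rhoBD c₁ c₂ c₃ * (pauliVec u ⊗ₖ pauliVec w)).trace).re =
      c₁ * (u 0 * w 0) + c₂ * (u 1 * w 1) + c₃ * (u 2 * w 2) := by
  simp [rhoBD, pauliVec, pauli, Matrix.trace, Matrix.mul_apply, Fintype.sum_prod_type,
    Fin.sum_univ_three, Matrix.one_apply]
  ring

lemma integral_comp_sphereMap {μ : Measure S2}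
    (hinv : ∀ f : E3 ≃ₗᵢ[ℝ] E3, μ.map (sphereMap f) = μ) (f : E3 ≃ₗᵢ[ℝ] E3)
    {g : S2 → ℝ} (hg : Continuous g) :
    ∫ x, g (sphereMap f x) ∂μ = ∫ x, g x ∂μ := by
  conv_rhs => rw [← hinv f]
  exact (integral_map (continuous_sphereMap f).aemeasurable hg.aestronglyMeasurable).symm

lemma integral_coords_mul_coords_of_ne {μ : Measure S2}
    (hinv : ∀ f : E3 ≃ₗᵢ[ℝ] E3, μ.map (sphereMap f) = μ) {i j : Fin 3} (hij : i ≠ j) :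
    ∫ x, coords x i * coords x j ∂μ = 0 := by
  have h := integral_comp_sphereMap hinv
    (LinearIsometryEquiv.piLpCongrRight 2 fun k : Fin 3 =>
      if k = i then LinearIsometryEquiv.neg ℝ else LinearIsometryEquiv.refl ℝ ℝ)
    ((continuous_coords i).mul (continuous_coords j))
  simp [coords, sphereMap, hij.symm, integral_neg] at h
  simp only [coords]
  linarith

lemma integral_coords_mul_self_eq {μ : Measure S2}
    (hinv : ∀ f : E3 ≃ₗᵢ[ℝ] E3, μ.map (sphereMap f) = μ) (i j : Fin 3) :
    ∫ x, coords x i * coords x i ∂μ = ∫ x, coords x j * coords x j ∂μ := by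
  have h := integral_comp_sphereMap hinv
    (LinearIsometryEquiv.piLpCongrLeft 2 ℝ ℝ (Equiv.swap i j))
    ((continuous_coords i).mul (continuous_coords i))
  simpa [coords, sphereMap, LinearIsometryEquiv.piLpCongrLeft_apply, Equiv.piCongrLeft'] using
    h.symm

lemma integral_coords_mul_self {μ : Measure S2} [IsProbabilityMeasure μ]
    (hinv : ∀ f : E3 ≃ₗᵢ[ℝ] E3, μ.map (sphereMap f) = μ) (i : Fin 3) :
    ∫ x, coords x i * coords x i ∂μ = 1 / 3 := by
  have hint (j : Fin 3) : Integrable (fun x => coords x j * coords x j) μ :=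
    ((continuous_coords j).mul (continuous_coords j)).integrable_of_hasCompactSupport
      (HasCompactSupport.of_compactSpace _)
  have hsum : ∑ j, ∫ x, coords x j * coords x j ∂μ = 1 := by
    rw [← integral_finsetSum _ fun j _ => hint j]
    have hnorm (x : S2) : ∑ j, coords x j * coords x j = 1 := by
      have h := EuclideanSpace.real_norm_sq_eq (x : E3)
      rw [mem_sphere_zero_iff_norm.mp x.2] at h
      simpa [coords, sq] using h.symm
    simp [hnorm]
  rw [Finset.sum_congr rfl fun j _ => integral_coords_mul_self_eq hinv j i] at hsum
  simp at hsum
  linarith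

lemma integral_coords_mul_coords {μ : Measure S2} [IsProbabilityMeasure μ]
    (hinv : ∀ f : E3 ≃ₗᵢ[ℝ] E3, μ.map (sphereMap f) = μ) (i j : Fin 3) :
    ∫ x, coords x i * coords x j ∂μ = if i = j then 1 / 3 else 0 := by
  split_ifs with h
  · subst h
    exact integral_coords_mul_self hinv i
  · exact integral_coords_mul_coords_of_ne hinv h

/-- for all real `c₁, c₂, c₃`, the second moment of the Bell-diagonal matrix
`ρ_BD(c₁,c₂,c₃)` satisfies `R^(2) = (c₁² + c₂² + c₃²)/9`, where `μ` is the
rotation-invariant (uniform) probability measure on `S²`. -/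
theorem bellDiagonal_second_moment (c₁ c₂ c₃ : ℝ)
    (μ : Measure S2) [IsProbabilityMeasure μ]
    (hinv : ∀ f : E3 ≃ₗᵢ[ℝ] E3, μ.map (sphereMap f) = μ) :
    twoQubitMoment μ (rhoBD c₁ c₂ c₃) 2 = (c₁ ^ 2 + c₂ ^ 2 + c₃ ^ 2) / 9 := by
  set c : Fin 3 → ℝ := ![c₁, c₂, c₃]
  have hexpand (p : S2 × S2) :
      ((rhoBD c₁ c₂ c₃ * (pauliVec (coords p.1) ⊗ₖ pauliVec (coords p.2))).trace).re ^ 2 =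
        ∑ i, ∑ j, c i * c j * ((coords p.1 i * coords p.1 j) * (coords p.2 i * coords p.2 j)) := by
    rw [trace_rhoBD_mul_pauliVec]
    simp only [Fin.sum_univ_three, c, cons_val]
    ring
  have hint (i j : Fin 3) : Integrable (fun p : S2 × S2 =>
      c i * c j * ((coords p.1 i * coords p.1 j) * (coords p.2 i * coords p.2 j))) (μ.prod μ) := by
    have hc (k : Fin 3) := continuous_coords k
    refine Continuous.integrable_of_hasCompactSupport ?_ (HasCompactSupport.of_compactSpace _)
    exact continuous_const.mul
      ((((hc i).comp continuous_fst).mul ((hc j).comp continuous_fst)).mul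
        (((hc i).comp continuous_snd).mul ((hc j).comp continuous_snd)))
  have hprod (i j : Fin 3) :
      ∫ p : S2 × S2, (coords p.1 i * coords p.1 j) * (coords p.2 i * coords p.2 j) ∂(μ.prod μ) =
        if i = j then 1 / 9 else 0 := by
    rw [integral_prod_mul (fun x => coords x i * coords x j) (fun x => coords x i * coords x j),
      integral_coords_mul_coords hinv]
    split_ifs <;> norm_num
  simp only [twoQubitMoment, hexpand]
  rw [integral_finsetSum _ fun i _ => integrable_finsetSum _ fun j _ => hint i j]
  simp only [integral_finsetSum _ fun j _ => hint _ j, integral_const_mul, hprod, mul_ite,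
    mul_zero, Finset.sum_ite_eq, Finset.mem_univ, if_true]
  simp only [Fin.sum_univ_three, c, cons_val]
  ring
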